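/- Let S and A be finite nonempty types, T : S × A → PMF S a Markov kernel, and μπ, μE probability mass functions on S × A whose induced joint distributions ρπ, ρE on S × A × S (ρ(s,a,s') = μ(s,a)·T(s,a)(s')) have equal state-transition marginals: ρπ(s,s') = ρE(s,s') for all (s,s'). Then the Jensen–Shannon gap between LfD and naive LfO equals the expected conditional Jensen–Shannon divergence of the inverse dynamics models: D_JS(μπ ‖ μE) − D_JS(ρπ(s,s') ‖ ρE(s,s')) = Σ_{(s,s') : ρπ(s,s') > 0} ρπ(s,s') · D_JS(ρπ(·|s,s') ‖ ρE(·|s,s')), where ρ(·|s,s') denotes the conditional distribution of a given (s,s'). -/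

import Mathlib

open scoped BigOperators

/-- Kullback–Leibler divergence: `D_KL(p ‖ q) = Σ_x p(x)·log(p(x)/q(x))`,
with terms where `p x = 0` equal to `0`. -/
noncomputable def klDiv {X : Type*} [Fintype X] (p q : X → ℝ) : ℝ :=
  ∑ x, p x * Real.log (p x / q x)

/-- Jensen–Shannon divergence:
`D_JS(p ‖ q) = (1/2)·D_KL(p ‖ m) + (1/2)·D_KL(q ‖ m)` with `m = (p + q)/2`. -/
noncomputable def jsDiv {X : Type*} [Fintype X] (p q : X → ℝ) : ℝ :=
  (1 / 2) * klDiv p (fun x => (p x + q x) / 2) +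
    (1 / 2) * klDiv q (fun x => (p x + q x) / 2)

/-- The real-valued mass function of a `PMF`. -/
noncomputable def pmfReal {X : Type*} (μ : PMF X) : X → ℝ := fun x => (μ x).toReal

/-- The joint distribution on `S × A × S` induced by a state-action occupancy
measure `μ` and a Markov kernel `T`: `ρ(s,a,s') = μ(s,a) · T(s,a)(s')`. -/
noncomputable def joint {S A : Type*} (T : S × A → PMF S) (μ : PMF (S × A)) :
    S × A × S → ℝ :=
  fun x => (μ (x.1, x.2.1)).toReal * ((T (x.1, x.2.1)) x.2.2).toReal

/-- The state-transition marginal `ρ(s,s') = Σ_a ρ(s,a,s')`. -/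
noncomputable def transMarg {S A : Type*} [Fintype A]
    (T : S × A → PMF S) (μ : PMF (S × A)) : S × S → ℝ :=
  fun p => ∑ a : A, joint T μ (p.1, a, p.2)

/-- The inverse dynamics model at a transition `(s,s')`: the conditional
distribution `a ↦ ρ(a|s,s') = ρ(s,a,s') / ρ(s,s')`, meaningful whenever
`ρ(s,s') > 0`. -/
noncomputable def invModel {S A : Type*} [Fintype A]
    (T : S × A → PMF S) (μ : PMF (S × A)) (p : S × S) : A → ℝ :=
  fun a => joint T μ (p.1, a, p.2) / transMarg T μ p

/-- The contribution of one point of mass `p`, `q` to the Jensen–Shannon divergence. -/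
noncomputable def jsTerm (p q : ℝ) : ℝ :=
  (1 / 2) * (p * Real.log (p / ((p + q) / 2))) + (1 / 2) * (q * Real.log (q / ((p + q) / 2)))

theorem jsDiv_eq_sum_jsTerm {X : Type*} [Fintype X] (p q : X → ℝ) :
    jsDiv p q = ∑ x, jsTerm (p x) (q x) := by
  simp only [jsDiv, klDiv, jsTerm, Finset.mul_sum, Finset.sum_add_distrib]

theorem jsTerm_self (p : ℝ) : jsTerm p p = 0 := by
  rcases eq_or_ne p 0 with rfl | hp
  · simp [jsTerm]
  · simp [jsTerm, div_self hp]

theorem jsDiv_self {X : Type*} [Fintype X] (p : X → ℝ) : jsDiv p p = 0 := by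
  simp [jsDiv_eq_sum_jsTerm, jsTerm_self]

theorem jsTerm_mul_right (c p q : ℝ) : jsTerm (p * c) (q * c) = jsTerm p q * c := by
  rcases eq_or_ne c 0 with rfl | hc
  · simp [jsTerm]
  · have h : (p * c + q * c) / 2 = (p + q) / 2 * c := by ring
    simp only [jsTerm, h, mul_div_mul_right _ _ hc]
    ring

theorem PMF.sum_toReal_eq_one {X : Type*} [Fintype X] (μ : PMF X) :
    ∑ x, (μ x).toReal = 1 := by
  rw [← ENNReal.toReal_sum fun x _ => μ.apply_ne_top x, ← tsum_fintype (L := .unconditional X), μ.tsum_coe,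
    ENNReal.toReal_one]

theorem joint_nonneg {S A : Type*} (T : S × A → PMF S) (μ : PMF (S × A)) (x : S × A × S) :
    0 ≤ joint T μ x :=
  mul_nonneg ENNReal.toReal_nonneg ENNReal.toReal_nonneg

theorem transMarg_nonneg {S A : Type*} [Fintype A] (T : S × A → PMF S) (μ : PMF (S × A))
    (p : S × S) : 0 ≤ transMarg T μ p :=
  Finset.sum_nonneg fun _ _ => joint_nonneg T μ _

theorem joint_eq_zero_of_transMarg_eq_zero {S A : Type*} [Fintype A] {T : S × A → PMF S}
    {μ : PMF (S × A)} {p : S × S} (h : transMarg T μ p = 0) (a : A) :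
    joint T μ (p.1, a, p.2) = 0 :=
  (Finset.sum_eq_zero_iff_of_nonneg fun _ _ => joint_nonneg T μ _).1 h a (Finset.mem_univ a)

theorem jsDiv_pmfReal_eq_sum_joint {S A : Type*} [Fintype S] [Fintype A]
    (T : S × A → PMF S) (μ ν : PMF (S × A)) :
    jsDiv (pmfReal μ) (pmfReal ν) =
      ∑ p : S × S, ∑ a, jsTerm (joint T μ (p.1, a, p.2)) (joint T ν (p.1, a, p.2)) := by
  simp only [jsDiv_eq_sum_jsTerm, pmfReal, joint, jsTerm_mul_right, Fintype.sum_prod_type]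
  refine Finset.sum_congr rfl fun s _ => ?_
  rw [Finset.sum_comm]
  simp only [← Finset.mul_sum, PMF.sum_toReal_eq_one, mul_one]

theorem transMarg_mul_jsDiv_invModel {S A : Type*} [Fintype A] {T : S × A → PMF S}
    {μ ν : PMF (S × A)} {p : S × S} (h : transMarg T μ p = transMarg T ν p)
    (hp : transMarg T μ p ≠ 0) :
    transMarg T μ p * jsDiv (invModel T μ p) (invModel T ν p) =
      ∑ a, jsTerm (joint T μ (p.1, a, p.2)) (joint T ν (p.1, a, p.2)) := by
  simp only [jsDiv_eq_sum_jsTerm, Finset.mul_sum, invModel, ← h]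
  refine Finset.sum_congr rfl fun a _ => ?_
  rw [mul_comm, ← jsTerm_mul_right, div_mul_cancel₀ _ hp, div_mul_cancel₀ _ hp]

/-- When the state-transition marginals coincide, the Jensen–Shannon gap
between LfD and naive LfO equals the expected conditional Jensen–Shannon
divergence of the inverse dynamics models. -/
theorem js_gap_eq_expected_js_invModel {S A : Type*}
    [Fintype S] [Fintype A] [Nonempty S] [Nonempty A]
    (T : S × A → PMF S) (μπ μE : PMF (S × A))
    (heq : ∀ p : S × S, transMarg T μπ p = transMarg T μE p) :
    jsDiv (pmfReal μπ) (pmfReal μE) - jsDiv (transMarg T μπ) (transMarg T μE) =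
      ∑ p ∈ Finset.univ.filter (fun p : S × S => 0 < transMarg T μπ p),
        transMarg T μπ p * jsDiv (invModel T μπ p) (invModel T μE p) := by
  rw [← funext heq, jsDiv_self, sub_zero, jsDiv_pmfReal_eq_sum_joint T, Finset.sum_filter]
  refine Finset.sum_congr rfl fun p _ => ?_
  split_ifs with hp
  · exact (transMarg_mul_jsDiv_invModel (heq p) hp.ne').symm
  · have h : transMarg T μπ p = 0 := le_antisymm (not_lt.1 hp) (transMarg_nonneg T μπ p)
    have h' : transMarg T μE p = 0 := heq p ▸ h
    simp [joint_eq_zero_of_transMarg_eq_zero h, joint_eq_zero_of_transMarg_eq_zero h',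
      jsTerm_self]
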